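/- Let n, r ∈ ℕ with n ≥ 2 and r > ⌈n/2⌉. Then firing from the pulse K(n,r) does not terminate uniquely: there exist two distinct stable configurations, each reachable from K(n,r) by firing moves. -/

import Mathlib

/-- Manhattan distance between faces of the grid. -/
def gdist (f g : ℤ × ℤ) : ℤ := |f.1 - g.1| + |f.2 - g.2|

/-- The marked face. -/
def f₀ : ℤ × ℤ := (0, 0)

/-- The Aztec diamond configuration `Az(n)`. -/
def Az (n : ℕ) : ℤ × ℤ → ℤ :=
  fun f => if f = f₀ then (n : ℤ) else max ((n : ℤ) - gdist f₀ f + 1) 0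

/-- The pulse `K(n,r)`: value `n` within Manhattan distance `r` of `f₀`, `0` elsewhere. -/
def pulse (n r : ℕ) : ℤ × ℤ → ℤ :=
  fun f => if gdist f₀ f ≤ (r : ℤ) then (n : ℤ) else 0

/-- A single firing move with marked face `f₀`. -/
def Fire (n : ℕ) (K K' : ℤ × ℤ → ℤ) : Prop :=
  (∃ f g : ℤ × ℤ, gdist f g = 1 ∧ f ≠ f₀ ∧ g ≠ f₀ ∧ K g + 2 ≤ K f ∧
      K' = Function.update (Function.update K f (K f - 1)) g (K g + 1)) ∨
  (∃ f : ℤ × ℤ, gdist f f₀ = 1 ∧ K f < (n : ℤ) ∧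
      K' = Function.update K f (K f + 1)) ∨
  (∃ f : ℤ × ℤ, gdist f f₀ = 1 ∧ (n : ℤ) < K f ∧
      K' = Function.update K f (K f - 1))

/-- `K'` is reachable from `K` by firing moves. -/
def Reaches (n : ℕ) (K K' : ℤ × ℤ → ℤ) : Prop :=
  Relation.ReflTransGen (Fire n) K K'

/-- A configuration is stable if no firing move applies. -/
def Stable (n : ℕ) (K : ℤ × ℤ → ℤ) : Prop := ∀ K', ¬ Fire n K K'

/-! ### Geometry of the grid -/

theorem gdist_eq_one {f g : ℤ × ℤ} (h : gdist f g = 1) :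
    (g.1 = f.1 ∧ (g.2 = f.2 + 1 ∨ g.2 = f.2 - 1)) ∨
      (g.2 = f.2 ∧ (g.1 = f.1 + 1 ∨ g.1 = f.1 - 1)) := by
  unfold gdist at h
  rcases abs_cases (f.1 - g.1) with h1 | h1 <;> rcases abs_cases (f.2 - g.2) with h2 | h2 <;> omega

theorem gdist_comm (f g : ℤ × ℤ) : gdist f g = gdist g f := by
  simp only [gdist, abs_sub_comm]

theorem gdist_triangle (p f g : ℤ × ℤ) : gdist p g ≤ gdist p f + gdist f g := by
  unfold gdist
  have h1 := abs_sub_le p.1 f.1 g.1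
  have h2 := abs_sub_le p.2 f.2 g.2
  linarith

theorem gdist_f₀ (x y : ℤ) : gdist f₀ (x, y) = |x| + |y| := by
  simp [gdist, f₀]

theorem ne_of_gdist_eq_one {f g : ℤ × ℤ} (h : gdist f g = 1) : f ≠ g := by
  rintro rfl
  simp [gdist] at h

/-! ### Barriers -/

/-- A 1-Lipschitz function which is at least `n` next to the marked face is an upper barrier for
firing. -/
theorem Fire.le_barrier {n : ℕ} {K K' U : ℤ × ℤ → ℤ} (hK : Fire n K K')
    (hU : ∀ f g, gdist f g = 1 → U f ≤ U g + 1) (hn : ∀ f, gdist f f₀ = 1 → (n : ℤ) ≤ U f)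
    (h : ∀ f, K f ≤ U f) (q : ℤ × ℤ) : K' q ≤ U q := by
  have hq := h q
  rcases hK with ⟨f, g, hfg, -, -, hlt, rfl⟩ | ⟨f, hf, hlt, rfl⟩ | ⟨f, hf, hlt, rfl⟩
  · have h1 := hU f g hfg
    have h2 := h f
    simp only [Function.update_apply]
    split_ifs with h3 h4
    · subst h3; omega
    · subst h4; omega
    · exact hq
  · have h1 := hn f hf
    simp only [Function.update_apply]
    split_ifs with h3
    · subst h3; omega
    · exact hq
  · simp only [Function.update_apply]
    split_ifs with h3
    · subst h3; omega
    · exact hq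

theorem Reaches.le_barrier {n : ℕ} {K K' U : ℤ × ℤ → ℤ} (hK : Reaches n K K')
    (hU : ∀ f g, gdist f g = 1 → U f ≤ U g + 1) (hn : ∀ f, gdist f f₀ = 1 → (n : ℤ) ≤ U f)
    (h : ∀ f, K f ≤ U f) : ∀ q, K' q ≤ U q := by
  induction hK with
  | refl => exact h
  | tail _ hs ih => exact hs.le_barrier hU hn ih

theorem Fire.nonneg {n : ℕ} {K K' : ℤ × ℤ → ℤ} (hK : Fire n K K')
    (h : ∀ f, 0 ≤ K f) (q : ℤ × ℤ) : 0 ≤ K' q := by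
  have hq := h q
  rcases hK with ⟨f, g, hfg, -, -, hlt, rfl⟩ | ⟨f, hf, hlt, rfl⟩ | ⟨f, hf, hlt, rfl⟩
  · have h1 := h g
    simp only [Function.update_apply]
    split_ifs with h3 h4 <;> omega
  · have h1 := h f
    simp only [Function.update_apply]
    split_ifs with h3 <;> omega
  · simp only [Function.update_apply]
    split_ifs with h3 <;> omega

theorem Reaches.nonneg {n : ℕ} {K K' : ℤ × ℤ → ℤ} (hK : Reaches n K K')
    (h : ∀ f, 0 ≤ K f) : ∀ q, 0 ≤ K' q := by
  induction hK with
  | refl => exact h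
  | tail _ hs ih => exact hs.nonneg ih

/-- Occupied faces stay occupied. -/
theorem Reaches.pos {n : ℕ} (hn : 1 ≤ n) {K K' : ℤ × ℤ → ℤ} (hK : Reaches n K K')
    (h : ∀ f, 0 ≤ K f) {p : ℤ × ℤ} (hp : 1 ≤ K p) : 1 ≤ K' p := by
  induction hK with
  | refl => exact hp
  | @tail K₁ K₂ hr hs ih =>
    have h0 := Reaches.nonneg hr h
    rcases hs with ⟨f, g, hfg, -, -, hlt, rfl⟩ | ⟨f, hf, hlt, rfl⟩ | ⟨f, hf, hlt, rfl⟩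
    · have h1 := h0 g
      simp only [Function.update_apply]
      split_ifs with h3 h4 <;> omega
    · have h1 := h0 f
      simp only [Function.update_apply]
      split_ifs with h3 <;> omega
    · simp only [Function.update_apply]
      split_ifs with h3 <;> omega

theorem Reaches.apply_f₀ {n : ℕ} {K K' : ℤ × ℤ → ℤ} (hK : Reaches n K K') : K' f₀ = K f₀ := by
  induction hK with
  | refl => rfl
  | tail _ hs ih =>
    rcases hs with ⟨f, g, hfg, hf, hg, hlt, rfl⟩ | ⟨f, hf, hlt, rfl⟩ | ⟨f, hf, hlt, rfl⟩
    · rw [Function.update_of_ne hg.symm, Function.update_of_ne hf.symm, ih]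
    · rw [Function.update_of_ne (ne_of_gdist_eq_one hf).symm, ih]
    · rw [Function.update_of_ne (ne_of_gdist_eq_one hf).symm, ih]

/-! ### Termination -/

/-- The values of `K` lie between `0` and a capped cone around the marked face. -/
def Confined (n r : ℕ) (K : ℤ × ℤ → ℤ) : Prop :=
  (∀ f, 0 ≤ K f) ∧ ∀ f, K f ≤ min (n : ℤ) (max ((n : ℤ) + r - gdist f₀ f) 0)

theorem Confined.reaches {n r : ℕ} (hr : 1 ≤ r) {K K' : ℤ × ℤ → ℤ} (h : Confined n r K)
    (hK : Reaches n K K') : Confined n r K' := by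
  refine ⟨hK.nonneg h.1, hK.le_barrier (fun f g hfg => ?_) (fun f hf => ?_) h.2⟩
  · have := gdist_triangle f₀ f g
    omega
  · rw [gdist_comm] at hf
    omega

theorem confined_pulse (n r : ℕ) : Confined n r (pulse n r) := by
  constructor <;> intro f <;> unfold pulse <;> split_ifs <;> omega

/-- The energy decreasing under firing. -/
noncomputable def energy (n r : ℕ) (K : ℤ × ℤ → ℤ) : ℤ :=
  ∑ f ∈ Finset.Icc ((-(n + r : ℤ), -(n + r : ℤ)) : ℤ × ℤ) ((n + r : ℤ), (n + r : ℤ)),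
    (K f - n) ^ 2

theorem mem_box {N : ℤ} {f : ℤ × ℤ} (h : gdist f₀ f ≤ N) :
    f ∈ Finset.Icc ((-N, -N) : ℤ × ℤ) (N, N) := by
  obtain ⟨x, y⟩ := f
  rw [gdist_f₀] at h
  have h1 := abs_nonneg x
  have h2 := abs_nonneg y
  have h3 := abs_le.1 (show |x| ≤ N by omega)
  have h4 := abs_le.1 (show |y| ≤ N by omega)
  simp only [Finset.mem_Icc, Prod.mk_le_mk]
  omega

theorem energy_lt {n r : ℕ} (hr : 1 ≤ r) {K K' : ℤ × ℤ → ℤ} (h : Confined n r K)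
    (hK : Fire n K K') : energy n r K' < energy n r K := by
  have single : ∀ f (v : ℤ), gdist f f₀ = 1 → (v - n) ^ 2 < (K f - n) ^ 2 →
      energy n r (Function.update K f v) < energy n r K := by
    intro f v hf hv
    have hf' : f ∈ Finset.Icc ((-(n + r : ℤ), -(n + r : ℤ)) : ℤ × ℤ) ((n + r : ℤ), (n + r : ℤ)) :=
      mem_box (by rw [gdist_comm, hf]; omega)
    refine Finset.sum_lt_sum (fun q _ => ?_) ⟨f, hf', by simpa using hv⟩
    by_cases hq : q = f
    · subst hq; simpa using hv.le
    · rw [Function.update_of_ne hq]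
  rcases hK with ⟨f, g, hfg, -, -, hlt, rfl⟩ | ⟨f, hf, hlt, rfl⟩ | ⟨f, hf, hlt, rfl⟩
  · have h1 := h.1 g
    have h2 := h.2 f
    have h3 := gdist_triangle f₀ f g
    have hne := ne_of_gdist_eq_one hfg
    unfold energy
    set S := Finset.Icc ((-(n + r : ℤ), -(n + r : ℤ)) : ℤ × ℤ) ((n + r : ℤ), (n + r : ℤ))
    have hf : f ∈ S := mem_box (by omega)
    have hg : g ∈ S.erase f := Finset.mem_erase.2 ⟨hne.symm, mem_box (by omega)⟩
    rw [← Finset.add_sum_erase S _ hf, ← Finset.add_sum_erase _ _ hg,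
      ← Finset.add_sum_erase S _ hf, ← Finset.add_sum_erase _ _ hg]
    have hrest : ∑ q ∈ (S.erase f).erase g,
        (Function.update (Function.update K f (K f - 1)) g (K g + 1) q - (n : ℤ)) ^ 2 =
        ∑ q ∈ (S.erase f).erase g, (K q - (n : ℤ)) ^ 2 := by
      refine Finset.sum_congr rfl fun q hq => ?_
      simp only [Finset.mem_erase] at hq
      rw [Function.update_of_ne hq.1, Function.update_of_ne hq.2.1]
    rw [hrest, Function.update_of_ne hne, Function.update_self, Function.update_self]
    nlinarith
  · exact single f _ hf (by nlinarith)
  · exact single f _ hf (by nlinarith)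

/-- Every subrelation of firing terminates. -/
theorem exists_terminal {n r : ℕ} (hr : 1 ≤ r) {R : (ℤ × ℤ → ℤ) → (ℤ × ℤ → ℤ) → Prop}
    (hR : ∀ K K', R K K' → Fire n K K') (K : ℤ × ℤ → ℤ) (h : Confined n r K) :
    ∃ K', Relation.ReflTransGen R K K' ∧ ∀ K'', ¬ R K' K'' := by
  induction hN : (energy n r K).toNat using Nat.strong_induction_on generalizing K with
  | _ N ih =>
    by_cases hT : ∃ K₁, R K K₁
    · obtain ⟨K₁, hK₁⟩ := hT
      have hF := hR _ _ hK₁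
      have hlt := energy_lt hr h hF
      have h0 : 0 ≤ energy n r K₁ := Finset.sum_nonneg fun _ _ => sq_nonneg _
      obtain ⟨K', h1, h2⟩ := ih _ (by omega) K₁
        (h.reaches hr (Relation.ReflTransGen.single hF)) rfl
      exact ⟨K', Relation.ReflTransGen.head hK₁ h1, h2⟩
    · exact ⟨K, .refl, fun K'' hK'' => hT ⟨K'', hK''⟩⟩

/-! ### Firing along lines -/

/-- A firing move between unmarked faces across an edge satisfying `E`. -/
def FireOn (E : ℤ × ℤ → ℤ × ℤ → Prop) (K K' : ℤ × ℤ → ℤ) : Prop :=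
  ∃ f g : ℤ × ℤ, E f g ∧ gdist f g = 1 ∧ f ≠ f₀ ∧ g ≠ f₀ ∧ K g + 2 ≤ K f ∧
    K' = Function.update (Function.update K f (K f - 1)) g (K g + 1)

theorem FireOn.fire {n : ℕ} {E : ℤ × ℤ → ℤ × ℤ → Prop} {K K' : ℤ × ℤ → ℤ}
    (h : FireOn E K K') : Fire n K K' :=
  let ⟨f, g, _, h⟩ := h
  .inl ⟨f, g, h⟩

theorem reaches_of_fireOn {n : ℕ} {E : ℤ × ℤ → ℤ × ℤ → Prop} {K K' : ℤ × ℤ → ℤ}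
    (h : Relation.ReflTransGen (FireOn E) K K') : Reaches n K K' :=
  Relation.ReflTransGen.mono (fun _ _ h => h.fire) _ _ h

theorem le_of_terminal {E : ℤ × ℤ → ℤ × ℤ → Prop} {K : ℤ × ℤ → ℤ} (h : ∀ K', ¬ FireOn E K K')
    {f g : ℤ × ℤ} (hE : E f g) (hfg : gdist f g = 1) (hf : f ≠ f₀) (hg : g ≠ f₀) :
    K f ≤ K g + 1 := by
  by_contra hlt
  exact h _ ⟨f, g, hE, hfg, hf, hg, by omega, rfl⟩

/-- A firing move `i → j` on a line. -/
def LineFire (h h' : ℤ → ℤ) (i j : ℤ) : Prop :=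
  (j = i + 1 ∨ j = i - 1) ∧ h j + 2 ≤ h i ∧
    h' = Function.update (Function.update h i (h i - 1)) j (h j + 1)

/-- `u` is a flow turning `h₀` into `h`. -/
def IsFlow (h₀ h u : ℤ → ℤ) : Prop := ∀ i, h i = h₀ i + u (i - 1) - u i

theorem LineFire.isFlow {h₀ h h' u : ℤ → ℤ} {i j : ℤ} (hl : LineFire h h' i j)
    (hu : IsFlow h₀ h u) :
    (j = i + 1 ∧ IsFlow h₀ h' (Function.update u i (u i + 1))) ∨
      (j = i - 1 ∧ IsFlow h₀ h' (Function.update u j (u j - 1))) := by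
  obtain ⟨rfl | rfl, -, rfl⟩ := hl
  · refine .inl ⟨rfl, fun k => ?_⟩
    have hk := hu k
    have hi := hu i
    have hi' := hu (i + 1)
    simp only [Function.update_apply]
    rcases eq_or_ne k i with rfl | h1
    · rw [if_neg (by omega), if_pos rfl, if_neg (by omega), if_pos rfl]; omega
    rcases eq_or_ne k (i + 1) with rfl | h2
    · rw [if_pos rfl, if_pos (by omega), if_neg (by omega), hi', add_sub_cancel_right]; omega
    rw [if_neg h2, if_neg h1, if_neg (by omega), if_neg h1, hk]
  · refine .inr ⟨rfl, fun k => ?_⟩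
    have hk := hu k
    have hi := hu i
    have hi' := hu (i - 1)
    simp only [Function.update_apply]
    rcases eq_or_ne k i with rfl | h1
    · rw [if_neg (by omega), if_pos rfl, if_pos rfl, if_neg (by omega)]; omega
    rcases eq_or_ne k (i - 1) with rfl | h2
    · rw [if_pos rfl, if_neg (by omega), if_pos rfl, hi']; omega
    rw [if_neg h2, if_neg h1, if_neg (by omega), if_neg h2, hk]

/-- The least action principle: a flow stabilizing from one side bounds every legal flow. -/
theorem LineFire.exists_flow_le {h₀ h h' v w u : ℤ → ℤ} {i j : ℤ} (hl : LineFire h h' i j)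
    (hv : ∀ k, h₀ k - h₀ (k + 1) + v (k - 1) - 2 * v k + v (k + 1) ≤ 1)
    (hw : ∀ k, h₀ (k + 1) - h₀ k + w (k - 1) - 2 * w k + w (k + 1) ≤ 1)
    (hu : IsFlow h₀ h u) (huv : ∀ k, u k ≤ v k) (huw : ∀ k, - w k ≤ u k) :
    ∃ u', IsFlow h₀ h' u' ∧ (∀ k, u' k ≤ v k) ∧ ∀ k, - w k ≤ u' k := by
  have hlt := hl.2.1
  rcases hl.isFlow hu with ⟨rfl, hu'⟩ | ⟨rfl, hu'⟩
  · refine ⟨_, hu', fun k => ?_, fun k => ?_⟩ <;> simp only [Function.update_apply] <;>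
      split_ifs with h1
    · subst h1
      have a := hu k
      have b := hu (k + 1)
      have c := hv k
      have d := huv (k - 1)
      have e := huv (k + 1)
      rw [add_sub_cancel_right] at b
      omega
    · exact huv k
    · subst h1
      have := huw k
      omega
    · exact huw k
  · refine ⟨_, hu', fun k => ?_, fun k => ?_⟩ <;> simp only [Function.update_apply] <;>
      split_ifs with h1
    · subst h1
      have := huv (i - 1)
      omega
    · exact huv k
    · subst h1
      have a := hu i
      have b := hu (i - 1)
      have c := hw (i - 1)
      have d := huw (i - 1 - 1)
      have e := huw i
      rw [sub_add_cancel] at c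
      omega
    · exact huw k

/-- Triangular numbers, extended by zero. -/
def tri (k : ℤ) : ℤ := ((k.toNat + 1).choose 2 : ℕ)

theorem tri_succ (k : ℤ) : tri (k + 1) = tri k + max (k + 1) 0 := by
  unfold tri
  rcases le_or_gt 0 k with h | h
  · obtain ⟨j, rfl⟩ := Int.eq_ofNat_of_zero_le h
    have : ((j : ℤ) + 1).toNat = j + 1 := by omega
    rw [this, Int.toNat_natCast, Nat.choose_succ_succ' (j + 1) 1]
    push_cast [Nat.choose_one_right]
    omega
  · have h1 : (k + 1).toNat = 0 := by omega
    have h2 : k.toNat = 0 := by omega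
    rw [h1, h2]
    omega

theorem tri_of_nonpos {k : ℤ} (h : k ≤ 0) : tri k = 0 := by
  unfold tri
  rw [Int.toNat_of_nonpos h]
  rfl

/-! ### Firing along columns -/

/-- The flow bound for the column at horizontal distance `r - s` from the marked face. -/
def columnFlow (m s k : ℤ) : ℤ := if 0 ≤ s then tri (m - |k - s|) else 0

theorem columnFlow_eq_zero {m s k : ℤ} (h : m ≤ |k - s|) : columnFlow m s k = 0 := by
  unfold columnFlow
  split_ifs
  · exact tri_of_nonpos (by omega)
  · rfl

theorem columnFlow_stable {n : ℕ} {m : ℤ} (hm : 0 ≤ m) (hn : (n : ℤ) ≤ 2 * m + 1) (s k : ℤ) :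
    (if |k| ≤ s then (n : ℤ) else 0) - (if |k + 1| ≤ s then (n : ℤ) else 0) +
      columnFlow m s (k - 1) - 2 * columnFlow m s k + columnFlow m s (k + 1) ≤ 1 := by
  unfold columnFlow
  rcases lt_or_ge s 0 with hs | hs
  · have h1 := abs_nonneg k
    have h2 := abs_nonneg (k + 1)
    rw [if_neg (by omega), if_neg (by omega)]
    simp [not_le.2 hs]
  simp only [if_pos hs]
  rcases lt_trichotomy k s with h | rfl | h
  · have e1 : |k - 1 - s| = s - k + 1 := by rw [abs_of_neg (by omega)]; ring
    have e2 : |k - s| = s - k := by rw [abs_of_neg (by omega)]; ring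
    have e3 : |k + 1 - s| = s - k - 1 := by rw [abs_of_nonpos (by omega)]; ring
    have t1 := tri_succ (m - (s - k + 1))
    have t2 := tri_succ (m - (s - k))
    rw [e1, e2, e3]
    rw [show m - (s - k + 1) + 1 = m - (s - k) by ring] at t1
    rw [show m - (s - k) + 1 = m - (s - k - 1) by ring] at t2
    have : (if |k| ≤ s then (n : ℤ) else 0) ≤ (if |k + 1| ≤ s then (n : ℤ) else 0) := by
      rcases abs_cases k with h1 | h1 <;> rcases abs_cases (k + 1) with h2 | h2 <;>
        split_ifs <;> omega
    omega
  · have e1 : |k - 1 - k| = 1 := by norm_num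
    have e2 : |k - k| = 0 := by norm_num
    have e3 : |k + 1 - k| = 1 := by norm_num
    have t1 := tri_succ (m - 1)
    rw [e1, e2, e3, sub_zero]
    rw [sub_add_cancel] at t1
    rw [if_pos (abs_of_nonneg hs).le, if_neg (by rw [abs_of_nonneg (by omega)]; omega)]
    omega
  · have e1 : |k - 1 - s| = k - s - 1 := by rw [abs_of_nonneg (by omega)]; ring
    have e2 : |k - s| = k - s := abs_of_pos (by omega)
    have e3 : |k + 1 - s| = k - s + 1 := by rw [abs_of_pos (by omega)]; ring
    have t1 := tri_succ (m - (k - s + 1))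
    have t2 := tri_succ (m - (k - s))
    rw [e1, e2, e3]
    rw [show m - (k - s + 1) + 1 = m - (k - s) by ring] at t1
    rw [show m - (k - s) + 1 = m - (k - s - 1) by ring] at t2
    rw [if_neg (by rw [abs_of_pos (by omega)]; omega),
      if_neg (by rw [abs_of_pos (by omega)]; omega)]
    omega

theorem pulse_column (n r : ℕ) (x y : ℤ) :
    pulse n r (x, y) = if |y| ≤ (r : ℤ) - |x| then (n : ℤ) else 0 := by
  unfold pulse
  rw [gdist_f₀]
  congr 1
  exact propext (by constructor <;> intro <;> omega)

/-- The edges of the columns. -/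
def Vertical (f g : ℤ × ℤ) : Prop := f.1 = g.1

theorem exists_columnFlow {n r : ℕ} {m : ℤ} (hm : 0 ≤ m) (hn : (n : ℤ) ≤ 2 * m + 1)
    {K : ℤ × ℤ → ℤ} (hK : Relation.ReflTransGen (FireOn Vertical) (pulse n r) K) (x : ℤ) :
    ∃ u, IsFlow (fun y => pulse n r (x, y)) (fun y => K (x, y)) u ∧
      (∀ k, u k ≤ columnFlow m (r - |x|) k) ∧ ∀ k, - columnFlow m (r - |x|) (-1 - k) ≤ u k := by
  have hpos : ∀ s k, 0 ≤ columnFlow m s k := by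
    intro s k
    unfold columnFlow tri
    split_ifs <;> positivity
  induction hK with
  | refl => exact ⟨fun _ => 0, fun y => by simp, fun k => hpos _ _, fun k => by simp [hpos]⟩
  | @tail K₁ K₂ hr hs ih =>
    obtain ⟨u, hu, huv, huw⟩ := ih
    obtain ⟨f, g, hE, hfg, -, -, hlt, rfl⟩ := hs
    by_cases hx : f.1 = x
    · obtain ⟨a, i⟩ := f
      obtain ⟨b, j⟩ := g
      simp only [Vertical] at hE hx
      subst hE hx
      have hadj := gdist_eq_one hfg
      have hl : LineFire (fun y => K₁ (a, y)) (fun y => Function.update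
          (Function.update K₁ (a, i) (K₁ (a, i) - 1)) (a, j) (K₁ (a, j) + 1) (a, y)) i j := by
        refine ⟨by simp only at hadj; omega, hlt, ?_⟩
        funext y
        simp [Function.update_apply]
      refine hl.exists_flow_le (w := fun k => columnFlow m (r - |a|) (-1 - k)) ?_ ?_ hu huv huw
      · intro k
        simp only [pulse_column]
        exact columnFlow_stable hm hn _ _
      · intro k
        simp only [pulse_column]
        have := columnFlow_stable hm hn (r - |a|) (-1 - k)
        rw [show |-1 - k| = |k + 1| by rw [← abs_neg]; congr 1; ring,
          show |-1 - k + 1| = |k| by rw [← abs_neg]; congr 1; ring] at this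
        rw [show -1 - (k - 1) = -1 - k + 1 by ring, show -1 - (k + 1) = -1 - k - 1 by ring]
        omega
    · have hx' : g.1 ≠ x := hE ▸ hx
      have : ∀ y, Function.update (Function.update K₁ f (K₁ f - 1)) g (K₁ g + 1) (x, y)
          = K₁ (x, y) := fun y => by
        rw [Function.update_of_ne fun h => hx' (by rw [← h]),
          Function.update_of_ne fun h => hx (by rw [← h])]
      simp only [this]
      exact ⟨u, hu, huv, huw⟩

theorem le_add_of_forall_le_succ {h : ℤ → ℤ} {a : ℤ} (hh : ∀ y, a ≤ y → h y ≤ h (y + 1) + 1)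
    (j : ℕ) : h a ≤ h (a + j) + j := by
  induction j with
  | zero => simp
  | succ j ih =>
    have := hh (a + j) (by omega)
    push_cast
    rw [add_assoc] at this
    omega

theorem eq_zero_of_columnFlow {m s k : ℤ} {a : ℤ} (h : s < 0 ∨ m + s ≤ k ∨ k ≤ -1 - s - m)
    (h₁ : a ≤ columnFlow m s k) (h₂ : - columnFlow m s (-1 - k) ≤ a) : a = 0 := by
  rcases lt_or_ge s 0 with hs | hs
  · simp only [columnFlow, if_neg (not_le.2 hs)] at h₁ h₂
    omega
  · rw [columnFlow_eq_zero] at h₁ h₂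
    · omega
    · rcases abs_cases (-1 - k - s) <;> omega
    · rcases abs_cases (k - s) <;> omega

theorem column_eq_zero {n r : ℕ} {m : ℤ} (hm : 0 ≤ m) (hn : (n : ℤ) ≤ 2 * m + 1)
    {K : ℤ × ℤ → ℤ} (hK : Relation.ReflTransGen (FireOn Vertical) (pulse n r) K) {x y : ℤ}
    (h : (r : ℤ) < |x| ∨ r + m < |x| + |y|) : K (x, y) = 0 := by
  obtain ⟨u, hu, huv, huw⟩ := exists_columnFlow hm hn hK x
  have hy := hu y
  have h1 := abs_cases y
  rw [eq_zero_of_columnFlow (by omega) (huv y) (huw y),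
    eq_zero_of_columnFlow (by omega) (huv (y - 1)) (huw (y - 1))] at hy
  simpa only [pulse_column, if_neg (show ¬ |y| ≤ r - |x| by omega), add_zero, sub_zero] using hy

/-- The columns of a configuration stable under firing along columns are 1-Lipschitz on either
side of the horizontal axis. -/
theorem column_le_add {K : ℤ × ℤ → ℤ} (hT : ∀ K', ¬ FireOn Vertical K K') {x y : ℤ}
    (hf : (x, y) ≠ f₀) (j : ℕ) :
    (0 ≤ y → K (x, y) ≤ K (x, y + j) + j) ∧ (y ≤ 0 → K (x, y) ≤ K (x, y - j) + j) := by
  simp only [f₀, ne_eq, Prod.mk.injEq, not_and] at hf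
  constructor
  · intro hy
    refine le_add_of_forall_le_succ (h := fun z => K (x, z)) (fun z hz => ?_) j
    refine le_of_terminal hT rfl (by simp [gdist]) ?_ ?_ <;>
    · simp only [f₀, ne_eq, Prod.mk.injEq, not_and]
      intro h
      have := hf h
      omega
  · intro hy
    have := le_add_of_forall_le_succ (h := fun z => K (x, -z)) (a := -y) (fun z hz => ?_) j
    · simpa only [neg_neg, neg_add, sub_eq_add_neg] using this
    · refine le_of_terminal hT rfl (by simp [gdist]) ?_ ?_ <;>
      · simp only [f₀, ne_eq, Prod.mk.injEq, not_and]
        intro h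
        have := hf h
        omega

theorem column_bound {n r : ℕ} {m : ℤ} (hm : 0 ≤ m) (hn : (n : ℤ) ≤ 2 * m + 1)
    {K : ℤ × ℤ → ℤ} (hK : Relation.ReflTransGen (FireOn Vertical) (pulse n r) K)
    (hT : ∀ K', ¬ FireOn Vertical K K') {x y : ℤ} (hf : (x, y) ≠ f₀) :
    K (x, y) ≤ max (r + m + 1 - |x| - |y|) 0 := by
  rcases lt_or_ge ((r : ℤ) + m) (|x| + |y|) with h | h
  · rw [column_eq_zero hm hn hK (.inr h)]
    omega
  obtain ⟨j, hj⟩ := Int.eq_ofNat_of_zero_le (show 0 ≤ r + m + 1 - |x| - |y| by omega)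
  have hl := column_le_add hT hf j
  rcases le_total 0 y with hy | hy
  · have := hl.1 hy
    rw [abs_of_nonneg hy] at hj ⊢
    rw [column_eq_zero hm hn hK (y := y + j) (.inr (by rw [abs_of_nonneg (show 0 ≤ y + j by omega)]; omega))] at this
    omega
  · have := hl.2 hy
    rw [abs_of_nonpos hy] at hj ⊢
    rw [column_eq_zero hm hn hK (y := y - j) (.inr (by rw [abs_of_nonpos (show y - j ≤ 0 by omega)]; omega))] at this
    omega

/-- For even `n`, conservation of mass in a column improves `column_bound` on the axis. -/
theorem column_center_bound {n r : ℕ} {m : ℤ} (hm : 0 ≤ m) (hn : (n : ℤ) = 2 * m)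
    {K : ℤ × ℤ → ℤ} (hK : Relation.ReflTransGen (FireOn Vertical) (pulse n r) K)
    (hT : ∀ K', ¬ FireOn Vertical K K') {x : ℤ} (hx : x ≠ 0) (hxr : |x| ≤ r) :
    K (x, 0) ≤ r + m - |x| := by
  by_contra! hlt
  obtain ⟨u, hu, huv, huw⟩ := exists_columnFlow hm (by omega) hK x
  obtain ⟨s, hs⟩ := Int.eq_ofNat_of_zero_le (show 0 ≤ (r : ℤ) - |x| by omega)
  obtain ⟨m, rfl⟩ := Int.eq_ofNat_of_zero_le hm
  rw [hs] at huv huw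
  have hf : (x, (0 : ℤ)) ≠ f₀ := by simp [f₀, hx]
  have key : ∀ N : ℕ, (2 * N + 1) * (m + s + 1) - N * (N + 1) ≤
      (n : ℤ) * (2 * (min N s : ℕ) + 1) + u (-N - 1) - u N := by
    intro N
    induction N with
    | zero =>
      have h0 := hu 0
      simp only [pulse_column, abs_zero, hs] at h0
      rw [if_pos (by omega)] at h0
      simp
      simp at h0
      linarith
    | succ N ih =>
      have h1 := hu (N + 1)
      have h2 := hu (-(N + 1))
      have l1 := (column_le_add hT hf (N + 1)).1 le_rfl
      have l2 := (column_le_add hT hf (N + 1)).2 le_rfl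
      have ha : |(N : ℤ) + 1| = N + 1 := abs_of_nonneg (by omega)
      simp only [pulse_column, abs_neg, ha, hs] at h1 h2
      push_cast at l1 l2 ⊢
      rw [zero_add] at l1
      rw [zero_sub] at l2
      rw [add_sub_cancel_right] at h1
      rw [show (-(N + 1) : ℤ) = -N - 1 by ring] at h2 l2 ⊢
      rcases le_or_gt (N + 1) s with hN | hN
      · rw [if_pos (by omega)] at h1 h2
        rw [min_eq_left (by omega)] at ih ⊢
        linarith
      · rw [if_neg (by omega)] at h1 h2
        rw [min_eq_right (by omega)] at ih ⊢
        linarith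
  have h := key (m + s)
  rw [eq_zero_of_columnFlow (by push_cast; omega) (huv _) (huw _),
    eq_zero_of_columnFlow (by push_cast; omega) (huv _) (huw _),
    min_eq_right (by omega), hn] at h
  push_cast at h
  nlinarith [sq_nonneg ((m : ℤ) - s)]

/-! ### Firing along a row -/

/-- The edges of the right half of the row at height `e`. -/
def RightRow (e : ℤ) (f g : ℤ × ℤ) : Prop := f.2 = e ∧ g.2 = e ∧ 1 ≤ f.1 ∧ 1 ≤ g.1

theorem exists_rowFlow {e : ℤ} {K₀ K : ℤ × ℤ → ℤ} (h₀ : ∀ f, 0 ≤ K₀ f)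
    (hK : Relation.ReflTransGen (FireOn (RightRow e)) K₀ K) (q : ℤ) :
    ∃ u, IsFlow (fun x => K₀ (x, e)) (fun x => K (x, e)) u ∧ u 0 = 0 ∧
      (1 ≤ K (q, e) ∨ u (q - 1) = 0) := by
  induction hK with
  | refl => exact ⟨fun _ => 0, fun y => by simp, rfl, .inr rfl⟩
  | @tail K₁ K₂ hr hs ih =>
    obtain ⟨u, hu, hu0, huq⟩ := ih
    have hpos := (reaches_of_fireOn (n := 0) hr).nonneg h₀
    obtain ⟨⟨i, a⟩, ⟨j, b⟩, ⟨hE1, hE2, hi, hj⟩, hfg, -, -, hlt, rfl⟩ := hs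
    simp only at hE1 hE2 hi hj
    subst hE1 hE2
    have hadj := gdist_eq_one hfg
    have hl : LineFire (fun x => K₁ (x, b)) (fun x => Function.update
        (Function.update K₁ (i, b) (K₁ (i, b) - 1)) (j, b) (K₁ (j, b) + 1) (x, b)) i j := by
      refine ⟨by simp only at hadj; omega, hlt, ?_⟩
      funext x
      simp [Function.update_apply]
    have hj0 := hpos (j, b)
    rcases hl.isFlow hu with ⟨rfl, hu'⟩ | ⟨rfl, hu'⟩
    · refine ⟨_, hu', by rw [Function.update_of_ne (by omega), hu0], ?_⟩
      rcases eq_or_ne q (i + 1) with rfl | h1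
      · left; simp; omega
      rw [Function.update_of_ne (show q - 1 ≠ i by omega)]
      refine huq.imp_left fun h => ?_
      simp only [Function.update_apply, Prod.mk.injEq, and_true]
      split_ifs <;> omega
    · refine ⟨_, hu', by rw [Function.update_of_ne (by omega), hu0], ?_⟩
      rcases eq_or_ne q i with rfl | h1
      · left; simp [Function.update_apply]; omega
      rw [Function.update_of_ne (show q - 1 ≠ i - 1 by omega)]
      refine huq.imp_left fun h => ?_
      simp only [Function.update_apply, Prod.mk.injEq, and_true]
      split_ifs <;> omega

/-- Firing a full row until it is stable occupies the face at distance `m` beyond its end. -/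
theorem one_le_of_row_terminal {n m e r : ℕ} (he : e < 2) (hn : n = 2 * m + e) (hm : 1 ≤ m)
    (hr : m + e < r) {K₀ K : ℤ × ℤ → ℤ} (h₀ : ∀ f, 0 ≤ K₀ f)
    (hK : Relation.ReflTransGen (FireOn (RightRow e)) K₀ K)
    (hT : ∀ K', ¬ FireOn (RightRow e) K K') (hKn : ∀ f, K f ≤ n)
    (hrow : ∀ x : ℤ, 1 ≤ x → x ≤ r - e → (n : ℤ) ≤ K₀ (x, e)) (hend : 1 ≤ K₀ (r, e)) :
    1 ≤ K ((r : ℤ) + m, e) := by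
  by_contra! hlt
  obtain ⟨u, hu, hu0, huq⟩ := exists_rowFlow h₀ hK ((r : ℤ) + m)
  replace huq := huq.resolve_left (by omega)
  have hf : ∀ x : ℤ, 1 ≤ x → (x, (e : ℤ)) ≠ f₀ := by
    intro x hx h
    simp only [f₀, Prod.mk.injEq] at h
    omega
  have hlip : ∀ j : ℕ, (j : ℤ) < r + m → K ((r : ℤ) + m - j, e) ≤ j := by
    intro j hj
    have := le_add_of_forall_le_succ (h := fun z => K (z, e)) (a := (r : ℤ) + m - j)
      (fun z hz => le_of_terminal hT ⟨rfl, rfl, by simp only; omega, by simp only; omega⟩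
        (by simp [gdist]) (hf _ (by omega)) (hf _ (by omega))) j
    simp only [sub_add_cancel] at this
    omega
  have hback : ∀ k : ℕ, k ≤ n → 2 * u ((r : ℤ) + m - 1 - k) ≤ k * (k + 1) -
      (if m + e ≤ k then 2 * (n : ℤ) * (k - m - e + 1) else 0) - (if m ≤ k then 2 * (e : ℤ) else 0) := by
    intro k
    induction k with
    | zero =>
      intro _
      rw [if_neg (by omega), if_neg (by omega)]
      simp [huq]
    | succ k ih =>
      intro hk
      have h1 := ih (by omega)
      have h2 := hu ((r : ℤ) + m - 1 - k)
      have h3 := hlip (k + 1) (by push_cast; omega)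
      have h4 : ((r : ℤ) + m - (k + 1 : ℕ)) = r + m - 1 - k := by push_cast; ring
      have h5 : ((r : ℤ) + m - 1 - (k + 1 : ℕ)) = r + m - 1 - k - 1 := by push_cast; ring
      have h6 := h₀ ((r : ℤ) + m - 1 - k, e)
      have h7 := hrow ((r : ℤ) + m - 1 - k) (by omega)
      rw [h4] at h3
      rw [h5]
      simp only at h2
      push_cast at h3 ⊢
      rcases lt_trichotomy (k + 1) m with h | h | h
      · rw [if_neg (by omega), if_neg (by omega)] at h1 ⊢
        linarith
      · rw [if_neg (by omega), if_neg (by omega)] at h1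
        rw [if_pos (show m ≤ k + 1 by omega)]
        have hx : (r : ℤ) + m - 1 - k = r := by omega
        rw [hx] at h2 h3 h7 h1 ⊢
        obtain rfl | rfl : e = 0 ∨ e = 1 := by omega
        · have := h7 (by omega)
          rw [if_pos (by omega)]
          have hk : (k : ℤ) + 1 - m = 0 := by omega
          push_cast
          rw [sub_zero, hk]
          linarith
        · rw [if_neg (by omega)]
          push_cast
          linarith
      · rw [if_pos (show m ≤ k by omega)] at h1
        rw [if_pos (show m ≤ k + 1 by omega), if_pos (show m + e ≤ k + 1 by omega)]
        have := h7 (by omega)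
        split_ifs at h1 with h8
        · linarith
        · have hk : (k : ℤ) + 1 - m - e = 0 := by omega
          rw [hk]
          linarith
  have hfwd : ∀ j : ℕ, (j : ℤ) ≤ r - e → 0 ≤ u j := by
    intro j
    induction j with
    | zero => intro _; simp [hu0]
    | succ j ih =>
      intro hj
      push_cast at hj ⊢
      have h1 := ih (by omega)
      have h2 := hu (j + 1)
      have h3 := hKn ((j : ℤ) + 1, e)
      have h4 := hrow (j + 1) (by omega) hj
      simp only [add_sub_cancel_right] at h2
      omega
  have h1 := hback n le_rfl
  have h2 := hfwd (r - m - e - 1) (by omega)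
  rw [show ((r - m - e - 1 : ℕ) : ℤ) = r + m - 1 - n by omega] at h2
  rw [if_pos (by omega), if_pos (by omega), hn] at h1
  rw [hn] at h2
  push_cast at h1 h2
  obtain rfl | rfl : e = 0 ∨ e = 1 := by omega
  · push_cast at h1 h2
    nlinarith
  · push_cast at h1 h2
    nlinarith

/-! ### Two outcomes -/

/-- Firing along columns avoids the face at distance `m` beyond the end of the row at height `e`. -/
theorem exists_stable_avoiding {n m e r : ℕ} (he : e < 2) (hn : n = 2 * m + e) (hr : m + e < r) :
    ∃ K, Reaches n (pulse n r) K ∧ Stable n K ∧ K ((r : ℤ) + m, e) ≤ 0 := by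
  obtain ⟨K, hK, hT⟩ := exists_terminal (R := FireOn Vertical) (show 1 ≤ r by omega)
    (fun _ _ h => h.fire) _ (confined_pulse n r)
  have hKr : Reaches n (pulse n r) K := reaches_of_fireOn hK
  obtain ⟨K', hK', hS⟩ := exists_terminal (show 1 ≤ r by omega) (fun _ _ h => h) K
    ((confined_pulse n r).reaches (by omega) hKr)
  refine ⟨K', hKr.trans hK', hS, ?_⟩
  have hbound : ∀ f, K f ≤ gdist ((r : ℤ) + m, e) f := by
    rintro ⟨x, y⟩
    by_cases hf : (x, y) = f₀
    · rw [hf, hKr.apply_f₀]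
      rw [f₀, pulse_column, if_pos (by simp)]
      simp only [gdist, sub_zero]
      rw [abs_of_nonneg (by omega), abs_of_nonneg (by omega)]
      omega
    have hb := column_bound (m := m) (by omega) (by omega) hK hT hf
    have hz := column_eq_zero (m := m) (by omega) (by omega) hK (x := x) (y := y)
    simp only [gdist]
    have a1 := abs_cases x
    have a2 := abs_cases y
    have a3 := abs_cases ((r : ℤ) + m - x)
    have a4 := abs_cases ((e : ℤ) - y)
    rcases lt_or_ge (r : ℤ) |x| with hx | hx
    · rw [hz (.inl hx)]
      omega
    obtain rfl | rfl : e = 0 ∨ e = 1 := by omega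
    · rcases eq_or_ne y 0 with rfl | hy
      · have hx0 : x ≠ 0 := by
          rintro rfl
          exact hf rfl
        have := column_center_bound (m := m) (by omega) (by omega) hK hT hx0 hx
        omega
      · omega
    · omega
  refine (Reaches.le_barrier (U := gdist ((r : ℤ) + m, e)) hK' (fun f g hfg => ?_)
    (fun f hf => ?_) hbound _).trans (by simp [gdist])
  · have := gdist_triangle ((r : ℤ) + m, (e : ℤ)) g f
    rw [gdist_comm g f] at this
    omega
  · have h1 := gdist_triangle ((r : ℤ) + m, (e : ℤ)) f f₀
    have h2 : gdist ((r : ℤ) + m, (e : ℤ)) f₀ = r + m + e := by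
      rw [gdist_comm, gdist_f₀, abs_of_nonneg (by omega), abs_of_nonneg (by omega)]
    omega

theorem exists_stable_of_row {n m e r : ℕ} (he : e < 2) (hn : n = 2 * m + e) (hm : 1 ≤ m)
    (hr : m + e < r) {K₀ : ℤ × ℤ → ℤ} (h₀ : Reaches n (pulse n r) K₀)
    (hrow : ∀ x : ℤ, 1 ≤ x → x ≤ r - e → (n : ℤ) ≤ K₀ (x, e)) (hend : 1 ≤ K₀ (r, e)) :
    ∃ K, Reaches n (pulse n r) K ∧ Stable n K ∧ 1 ≤ K ((r : ℤ) + m, e) := by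
  have hc := (confined_pulse n r).reaches (by omega) h₀
  obtain ⟨K, hK, hT⟩ := exists_terminal (R := FireOn (RightRow e)) (show 1 ≤ r by omega)
    (fun _ _ h => h.fire) K₀ hc
  have hKr : Reaches n K₀ K := reaches_of_fireOn hK
  have hc' := hc.reaches (by omega) hKr
  obtain ⟨K', hK', hS⟩ := exists_terminal (show 1 ≤ r by omega) (fun _ _ h => h) K hc'
  exact ⟨K', (h₀.trans hKr).trans hK', hS, Reaches.pos (by omega) hK' hc'.1
    (one_le_of_row_terminal he hn hm hr hc.1 hK hT
      (fun f => (hc'.2 f).trans (min_le_left _ _)) hrow hend)⟩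

/-- Firing along the row at height `e` occupies the face at distance `m` beyond its end. -/
theorem exists_stable_occupying {n m e r : ℕ} (he : e < 2) (hn : n = 2 * m + e) (hm : 1 ≤ m)
    (hr : m + e < r) :
    ∃ K, Reaches n (pulse n r) K ∧ Stable n K ∧ 1 ≤ K ((r : ℤ) + m, e) := by
  obtain rfl | rfl : e = 0 ∨ e = 1 := by omega
  · refine exists_stable_of_row he hn hm hr .refl (fun x hx hxr => ?_) ?_ <;>
      rw [pulse_column, if_pos]
    · simp only [Nat.cast_zero, abs_zero]
      rw [abs_of_nonneg (by omega)]
      omega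
    · omega
    · simp
  · have h1 : pulse n r ((r : ℤ), 0) = n := by rw [pulse_column, if_pos (by simp)]
    have h2 : pulse n r ((r : ℤ), 1) = 0 := by rw [pulse_column, if_neg (by simp)]
    have hfire : Fire n (pulse n r) (Function.update (Function.update (pulse n r) ((r : ℤ), 0)
        (pulse n r ((r : ℤ), 0) - 1)) ((r : ℤ), 1) (pulse n r ((r : ℤ), 1) + 1)) := by
      refine .inl ⟨((r : ℤ), 0), ((r : ℤ), 1), by simp [gdist], ?_, by simp [f₀], by omega, rfl⟩
      simp only [f₀, ne_eq, Prod.mk.injEq]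
      omega
    refine exists_stable_of_row he hn hm hr (.single hfire) (fun x hx hxr => ?_) ?_
    · rw [Function.update_of_ne, Function.update_of_ne (by simp), pulse_column, if_pos]
      · simp only [Nat.cast_one, abs_one] at hxr ⊢
        rw [abs_of_nonneg (by omega)]
        omega
      · simp only [ne_eq, Prod.mk.injEq]
        omega
    · simp [h2]

theorem third_regime_not_unique
    (n r : ℕ) (hn : 2 ≤ n) (hr : (n + 1) / 2 < r) :
    ∃ K₁ K₂ : ℤ × ℤ → ℤ,
      Reaches n (pulse n r) K₁ ∧ Stable n K₁ ∧
      Reaches n (pulse n r) K₂ ∧ Stable n K₂ ∧ K₁ ≠ K₂ := by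
  obtain ⟨K₁, h1, s1, p1⟩ := exists_stable_occupying (n := n) (m := n / 2) (e := n % 2) (r := r)
    (by omega) (by omega) (by omega) (by omega)
  obtain ⟨K₂, h2, s2, p2⟩ := exists_stable_avoiding (n := n) (m := n / 2) (e := n % 2) (r := r)
    (by omega) (by omega) (by omega)
  refine ⟨K₁, K₂, h1, s1, h2, s2, ?_⟩
  rintro rfl
  omega
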